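/- arXiv:2305.05069 — 2 statements merged into one kernel-verified Lean document; each statement's English description precedes it below -/
import Mathlib

section
/- Let d ≥ 1, let ξ ∈ ℝ^d, let F₁', F₁'', F₂', F₂'' ∈ ℝ^d, and let σ', σ'' be real numbers with σ' > 0 and σ'' > 0. Then the absolute value of the determinant of the 6×6 complex matrix M(ξ) equals 2σ'σ''·|ξ|⁶·(σ'² + σ''²) · | |F₁|²·|F₂·ξ|² − |F₂|²·|F₁·ξ|² |. -/
open Matrix Complex

/-- The 6×6 principal symbol matrix `M(ξ)` of the linearized complex-conductivity
inverse problem with `n = 2` experiments. Here `⬝ᵥ` is the Euclidean inner product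
on `ℝ^d`, so `ξ ⬝ᵥ ξ = |ξ|²`. -/
noncomputable def symbolM {d : ℕ} (ξ F₁' F₁'' F₂' F₂'' : Fin d → ℝ) (σ' σ'' : ℝ) :
    Matrix (Fin 6) (Fin 6) ℂ :=
  !![((F₁' ⬝ᵥ F₁' + F₁'' ⬝ᵥ F₁'' : ℝ) : ℂ), 0, ((2 * σ' * (F₁' ⬝ᵥ ξ) : ℝ) : ℂ) * I,
       ((2 * σ' * (F₁'' ⬝ᵥ ξ) : ℝ) : ℂ) * I, 0, 0;
     ((F₂' ⬝ᵥ F₂' + F₂'' ⬝ᵥ F₂'' : ℝ) : ℂ), 0, 0, 0, ((2 * σ' * (F₂' ⬝ᵥ ξ) : ℝ) : ℂ) * I,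
       ((2 * σ' * (F₂'' ⬝ᵥ ξ) : ℝ) : ℂ) * I;
     ((F₁' ⬝ᵥ ξ : ℝ) : ℂ) * I, -((F₁'' ⬝ᵥ ξ : ℝ) : ℂ) * I, ((-(σ' * (ξ ⬝ᵥ ξ)) : ℝ) : ℂ),
       ((σ'' * (ξ ⬝ᵥ ξ) : ℝ) : ℂ), 0, 0;
     ((F₁'' ⬝ᵥ ξ : ℝ) : ℂ) * I, ((F₁' ⬝ᵥ ξ : ℝ) : ℂ) * I, ((-(σ'' * (ξ ⬝ᵥ ξ)) : ℝ) : ℂ),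
       ((-(σ' * (ξ ⬝ᵥ ξ)) : ℝ) : ℂ), 0, 0;
     ((F₂' ⬝ᵥ ξ : ℝ) : ℂ) * I, -((F₂'' ⬝ᵥ ξ : ℝ) : ℂ) * I, 0, 0, ((-(σ' * (ξ ⬝ᵥ ξ)) : ℝ) : ℂ),
       ((σ'' * (ξ ⬝ᵥ ξ) : ℝ) : ℂ);
     ((F₂'' ⬝ᵥ ξ : ℝ) : ℂ) * I, ((F₂' ⬝ᵥ ξ : ℝ) : ℂ) * I, 0, 0, ((-(σ'' * (ξ ⬝ᵥ ξ)) : ℝ) : ℂ),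
       ((-(σ' * (ξ ⬝ᵥ ξ)) : ℝ) : ℂ)]

/-- Over any commutative ring, the determinant of a matrix of the shape of `symbolM`, with
`P, Q` for `|F₁|², |F₂|²`, the pairs `(a, b)`, `(c, e)` for the components of `F₁·ξ`, `F₂·ξ`,
and `r` for `|ξ|²`. -/
lemma det_symbol_shape {R : Type*} [CommRing R] (P Q a b c e s t r i : R) :
    (!![P, 0, 2 * s * a * i, 2 * s * b * i, 0, 0;
        Q, 0, 0, 0, 2 * s * c * i, 2 * s * e * i;
        a * i, -b * i, -(s * r), t * r, 0, 0;
        b * i, a * i, -(t * r), -(s * r), 0, 0;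
        c * i, -e * i, 0, 0, -(s * r), t * r;
        e * i, c * i, 0, 0, -(t * r), -(s * r)] : Matrix (Fin 6) (Fin 6) R).det =
      i ^ 2 * (2 * s * t * r ^ 3 * (s ^ 2 + t ^ 2) *
        (P * (c ^ 2 + e ^ 2) - Q * (a ^ 2 + b ^ 2))) := by
  simp [det_succ_row_zero, Fin.sum_univ_succ, Fin.succAbove]
  ring

/-- For `σ' > 0` and `σ'' > 0`, the absolute value of the determinant of the principal
symbol `M(ξ)` equals `2σ'σ''·|ξ|⁶·(σ'² + σ''²)·||F₁|²·|F₂·ξ|² − |F₂|²·|F₁·ξ|²|`.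
Here `|ξ|⁶ = (ξ ⬝ᵥ ξ)³`. -/
theorem symbolM_abs_det {d : ℕ} (hd : 1 ≤ d) (ξ F₁' F₁'' F₂' F₂'' : Fin d → ℝ)
    (σ' σ'' : ℝ) (hσ' : 0 < σ') (hσ'' : 0 < σ'') :
    ‖(symbolM ξ F₁' F₁'' F₂' F₂'' σ' σ'').det‖ =
      2 * σ' * σ'' * (ξ ⬝ᵥ ξ) ^ 3 * (σ' ^ 2 + σ'' ^ 2) *
        |(F₁' ⬝ᵥ F₁' + F₁'' ⬝ᵥ F₁'') * ((F₂' ⬝ᵥ ξ) ^ 2 + (F₂'' ⬝ᵥ ξ) ^ 2) -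
         (F₂' ⬝ᵥ F₂' + F₂'' ⬝ᵥ F₂'') * ((F₁' ⬝ᵥ ξ) ^ 2 + (F₁'' ⬝ᵥ ξ) ^ 2)| := by
  have hr : 0 ≤ ξ ⬝ᵥ ξ := Finset.sum_nonneg fun i _ => mul_self_nonneg (ξ i)
  have hdet : (symbolM ξ F₁' F₁'' F₂' F₂'' σ' σ'').det =
      ((-(2 * σ' * σ'' * (ξ ⬝ᵥ ξ) ^ 3 * (σ' ^ 2 + σ'' ^ 2) *
        ((F₁' ⬝ᵥ F₁' + F₁'' ⬝ᵥ F₁'') * ((F₂' ⬝ᵥ ξ) ^ 2 + (F₂'' ⬝ᵥ ξ) ^ 2) -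
         (F₂' ⬝ᵥ F₂' + F₂'' ⬝ᵥ F₂'') * ((F₁' ⬝ᵥ ξ) ^ 2 + (F₁'' ⬝ᵥ ξ) ^ 2))) : ℝ) : ℂ) := by
    simp only [symbolM, ofReal_add, ofReal_sub, ofReal_mul, ofReal_neg, ofReal_pow, ofReal_ofNat]
    rw [det_symbol_shape, I_sq, neg_one_mul]
  rw [hdet, norm_real, Real.norm_eq_abs, abs_neg, abs_mul, abs_of_nonneg (by positivity)]
end

section
/- Let d ≥ 1, n ≥ 2, let ξ ∈ ℝ^d, let F_j', F_j'' ∈ ℝ^d for j = 1, …, n, and let σ', σ'' be real numbers with σ' > 0 and σ'' > 0. Then the absolute value of the determinant of the (2n+2) × (2n+2) complex matrix S(ξ) equals 2σ'σ''·|ξ|^(4n−2)·(σ'² + σ''²)^(n−1) · | |F₁|²·|F₂·ξ|² − |F₂|²·|F₁·ξ|² |. -/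
open Matrix Complex

/-- The `(2n+2) × (2n+2)` maximal square sub-matrix `S(ξ)` of the principal symbol of
the linearized complex-conductivity problem, obtained by keeping only the measurement
rows of the first two experiments. Rows `0` and `1` are the measurement rows of
experiments `0` and `1`; for each `j = 0, …, n-1` the rows `2j+2`, `2j+3` form the
`j`-th pair of field rows, with nonzero entries only in columns `0`, `1`, `2j+2` and
`2j+3`. Here `⬝ᵥ` is the Euclidean inner product, so `ξ ⬝ᵥ ξ = |ξ|²`. -/
noncomputable def symbolS {d n : ℕ} (hn : 2 ≤ n) (ξ : Fin d → ℝ)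
    (F' F'' : Fin n → Fin d → ℝ) (σ' σ'' : ℝ) :
    Matrix (Fin (2 * n + 2)) (Fin (2 * n + 2)) ℂ :=
  fun r c =>
    if hr : (r : ℕ) < 2 then
      let j : Fin n := ⟨(r : ℕ), by omega⟩
      if (c : ℕ) = 0 then ((F' j ⬝ᵥ F' j + F'' j ⬝ᵥ F'' j : ℝ) : ℂ)
      else if (c : ℕ) = 2 * (r : ℕ) + 2 then ((2 * σ' * (F' j ⬝ᵥ ξ) : ℝ) : ℂ) * I
      else if (c : ℕ) = 2 * (r : ℕ) + 3 then ((2 * σ' * (F'' j ⬝ᵥ ξ) : ℝ) : ℂ) * I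
      else 0
    else
      let j : Fin n := ⟨((r : ℕ) - 2) / 2, by have := r.isLt; omega⟩
      let i : ℕ := ((r : ℕ) - 2) % 2
      if (c : ℕ) = 0 then
        if i = 0 then ((F' j ⬝ᵥ ξ : ℝ) : ℂ) * I else ((F'' j ⬝ᵥ ξ : ℝ) : ℂ) * I
      else if (c : ℕ) = 1 then
        if i = 0 then -((F'' j ⬝ᵥ ξ : ℝ) : ℂ) * I else ((F' j ⬝ᵥ ξ : ℝ) : ℂ) * I
      else if (c : ℕ) = 2 * (j : ℕ) + 2 then
        if i = 0 then ((-(σ' * (ξ ⬝ᵥ ξ)) : ℝ) : ℂ) else ((-(σ'' * (ξ ⬝ᵥ ξ)) : ℝ) : ℂ)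
      else if (c : ℕ) = 2 * (j : ℕ) + 3 then
        if i = 0 then ((σ'' * (ξ ⬝ᵥ ξ) : ℝ) : ℂ) else ((-(σ' * (ξ ⬝ᵥ ξ)) : ℝ) : ℂ)
      else 0

namespace Matrix

/-- The Schur complement formula with the product `D⁻¹ C` replaced by a solution of `D X = C`. -/
theorem det_fromBlocks_of_mul_eq {m k R : Type*} [Fintype m] [DecidableEq m] [Fintype k]
    [DecidableEq k] [CommRing R] (A : Matrix m m R) (B : Matrix m k R) (C X : Matrix k m R)
    (D : Matrix k k R) (h : D * X = C) :
    (fromBlocks A B C D).det = (A - B * X).det * D.det := by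
  have key : fromBlocks A B C D * fromBlocks 1 0 (-X) 1 = fromBlocks (A - B * X) B 0 D := by
    simp [fromBlocks_multiply, h, sub_eq_add_neg]
  simpa using congrArg det key

end Matrix

/-- The splitting of the indices of `symbolS` into the first two and the `n` subsequent pairs. -/
def symbolIndexEquiv (n : ℕ) : Fin 2 ⊕ (Fin 2 × Fin n) ≃ Fin (2 * n + 2) :=
  (Equiv.sumCongr (Equiv.refl _) ((Equiv.prodComm _ _).trans finProdFinEquiv)).trans
    (finSumFinEquiv.trans (finCongr (by omega)))

theorem symbolIndexEquiv_inl (n : ℕ) (i : Fin 2) :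
    (symbolIndexEquiv n (Sum.inl i) : ℕ) = i := by
  simp [symbolIndexEquiv]

theorem symbolIndexEquiv_inr (n : ℕ) (i : Fin 2) (j : Fin n) :
    (symbolIndexEquiv n (Sum.inr (i, j)) : ℕ) = 2 * j + 2 + i := by
  simp [symbolIndexEquiv]
  omega

/-- The measurement block `|F_r|²` in the first two columns. -/
def powerBlock {n : ℕ} (hn : 2 ≤ n) (f : Fin n → ℂ) : Matrix (Fin 2) (Fin 2) ℂ :=
  of fun r c => ![f (Fin.castLE hn r), 0] c

/-- The measurement block in the field columns. -/
noncomputable def powerFieldBlock {n : ℕ} (hn : 2 ≤ n) (a b : Fin n → ℂ) (σ' : ℂ) :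
    Matrix (Fin 2) (Fin 2 × Fin n) ℂ :=
  of fun r p => if p.2 = Fin.castLE hn r then 2 * σ' * ![a p.2, b p.2] p.1 * I else 0

/-- The column of blocks `[[a j, -b j], [b j, a j]]`, scaled by `t`. -/
def rotationColumn {n : ℕ} (a b : Fin n → ℂ) (t : ℂ) : Matrix (Fin 2 × Fin n) (Fin 2) ℂ :=
  of fun p c => t * !![a p.2, -b p.2; b p.2, a p.2] p.1 c

/-- The diagonal block of the field equations. -/
def fieldBlock (s σ' σ'' : ℂ) : Matrix (Fin 2) (Fin 2) ℂ :=
  !![-(σ' * s), σ'' * s; -(σ'' * s), -(σ' * s)]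

theorem det_fieldBlock (s σ' σ'' : ℂ) :
    (fieldBlock s σ' σ'').det = s ^ 2 * (σ' ^ 2 + σ'' ^ 2) := by
  rw [fieldBlock, det_fin_two_of]
  ring

theorem blockDiagonal_fieldBlock_mul_rotationColumn {n : ℕ} (a b : Fin n → ℂ) {s σ' σ'' : ℂ}
    (hs : s ≠ 0) (hσ : σ' ^ 2 + σ'' ^ 2 ≠ 0) :
    blockDiagonal (fun _ : Fin n => fieldBlock s σ' σ'') *
      rotationColumn (fun j => a j * σ' + b j * σ'') (fun j => b j * σ' - a j * σ'')
        (-I / (s * (σ' ^ 2 + σ'' ^ 2))) = rotationColumn a b I := by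
  ext ⟨i, j⟩ c
  fin_cases i <;> fin_cases c <;>
    simp [mul_apply, Fintype.sum_prod_type, blockDiagonal_apply, rotationColumn, fieldBlock] <;>
    field_simp <;> ring

theorem det_powerBlock_sub {n : ℕ} (hn : 2 ≤ n) (a b f : Fin n → ℂ) {s σ' σ'' : ℂ}
    (hs : s ≠ 0) (hσ : σ' ^ 2 + σ'' ^ 2 ≠ 0) :
    (powerBlock hn f - powerFieldBlock hn a b σ' *
      rotationColumn (fun j => a j * σ' + b j * σ'') (fun j => b j * σ' - a j * σ'')
        (-I / (s * (σ' ^ 2 + σ'' ^ 2)))).det * (s * (σ' ^ 2 + σ'' ^ 2)) =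
    -(2 * σ' * σ'' *
      (f (Fin.castLE hn 0) * (a (Fin.castLE hn 1) ^ 2 + b (Fin.castLE hn 1) ^ 2) -
        f (Fin.castLE hn 1) * (a (Fin.castLE hn 0) ^ 2 + b (Fin.castLE hn 0) ^ 2))) := by
  have entry (r c : Fin 2) : (powerFieldBlock hn a b σ' *
      rotationColumn (fun j => a j * σ' + b j * σ'') (fun j => b j * σ' - a j * σ'')
        (-I / (s * (σ' ^ 2 + σ'' ^ 2)))) r c =
      2 * σ' * (a (Fin.castLE hn r) ^ 2 + b (Fin.castLE hn r) ^ 2) /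
        (s * (σ' ^ 2 + σ'' ^ 2)) * ![σ', σ''] c := by
    fin_cases c <;>
      simp [mul_apply, Fintype.sum_prod_type, powerFieldBlock, rotationColumn] <;>
      field_simp <;> simp only [I_sq] <;> ring
  rw [det_fin_two]
  simp only [Matrix.sub_apply, entry, powerBlock, of_apply, cons_val_zero, cons_val_one]
  field_simp
  ring

theorem symbolS_submatrix {d n : ℕ} (hn : 2 ≤ n) (ξ : Fin d → ℝ)
    (F' F'' : Fin n → Fin d → ℝ) (σ' σ'' : ℝ) :
    (symbolS hn ξ F' F'' σ' σ'').submatrix (symbolIndexEquiv n) (symbolIndexEquiv n) =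
      fromBlocks
        (powerBlock hn fun j => ((F' j ⬝ᵥ F' j + F'' j ⬝ᵥ F'' j : ℝ) : ℂ))
        (powerFieldBlock hn (fun j => ((F' j ⬝ᵥ ξ : ℝ) : ℂ)) (fun j => ((F'' j ⬝ᵥ ξ : ℝ) : ℂ)) σ')
        (rotationColumn (fun j => ((F' j ⬝ᵥ ξ : ℝ) : ℂ)) (fun j => ((F'' j ⬝ᵥ ξ : ℝ) : ℂ)) I)
        (blockDiagonal fun _ => fieldBlock ((ξ ⬝ᵥ ξ : ℝ) : ℂ) σ' σ'') := by
  have pair_div (j : ℕ) : (2 * j + 1) / 2 = j := by omega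
  have pair_mod (j : ℕ) : (2 * j + 1) % 2 = 1 := by omega
  ext (r | ⟨i, j⟩) (c | ⟨i', j'⟩)
  · fin_cases r <;> fin_cases c <;>
      simp [symbolS, symbolIndexEquiv_inl, powerBlock, Fin.castLE]
  · fin_cases r <;> fin_cases i' <;>
      simp [symbolS, symbolIndexEquiv_inl, symbolIndexEquiv_inr, powerFieldBlock, Fin.ext_iff]
    all_goals
      obtain ⟨j', hj'⟩ := j'
      split_ifs <;> first | rfl | (subst_vars; rfl) | omega
  · fin_cases i <;> fin_cases c <;>
      simp [symbolS, symbolIndexEquiv_inl, symbolIndexEquiv_inr, rotationColumn,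
        pair_div, pair_mod, mul_comm I]
  · fin_cases i <;> fin_cases i' <;>
      simp [symbolS, symbolIndexEquiv_inr, blockDiagonal_apply, fieldBlock, Fin.ext_iff,
        pair_div, pair_mod]
    all_goals split_ifs <;> first | rfl | omega

/-- For `σ' > 0` and `σ'' > 0`, the absolute value of the determinant of `S(ξ)` equals
`2σ'σ''·|ξ|^(4n−2)·(σ'² + σ''²)^(n−1)·||F₁|²·|F₂·ξ|² − |F₂|²·|F₁·ξ|²|`.
Here `|ξ|^(4n−2) = (ξ ⬝ᵥ ξ)^(2n−1)`. -/
theorem symbolS_abs_det {d n : ℕ} (hd : 1 ≤ d) (hn : 2 ≤ n) (ξ : Fin d → ℝ)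
    (F' F'' : Fin n → Fin d → ℝ) (σ' σ'' : ℝ) (hσ' : 0 < σ') (hσ'' : 0 < σ'') :
    letI F₁' := F' ⟨0, by omega⟩
    letI F₁'' := F'' ⟨0, by omega⟩
    letI F₂' := F' ⟨1, by omega⟩
    letI F₂'' := F'' ⟨1, by omega⟩
    ‖(symbolS hn ξ F' F'' σ' σ'').det‖ =
      2 * σ' * σ'' * (ξ ⬝ᵥ ξ) ^ (2 * n - 1) * (σ' ^ 2 + σ'' ^ 2) ^ (n - 1) *
        |(F₁' ⬝ᵥ F₁' + F₁'' ⬝ᵥ F₁'') * ((F₂' ⬝ᵥ ξ) ^ 2 + (F₂'' ⬝ᵥ ξ) ^ 2) -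
         (F₂' ⬝ᵥ F₂' + F₂'' ⬝ᵥ F₂'') * ((F₁' ⬝ᵥ ξ) ^ 2 + (F₁'' ⬝ᵥ ξ) ^ 2)| := by
  by_cases hξ : ξ = 0
  · have hcol : (symbolS hn ξ F' F'' σ' σ'').det = 0 := by
      refine det_eq_zero_of_column_eq_zero ⟨1, by omega⟩ fun r => ?_
      simp [symbolS, hξ]
    have hpow : 2 * n - 1 ≠ 0 := by omega
    rw [hcol]
    simp [hξ, hpow]
  have hs : ((ξ ⬝ᵥ ξ : ℝ) : ℂ) ≠ 0 := by
    exact_mod_cast mt dotProduct_self_eq_zero.mp hξ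
  have hσ : (σ' : ℂ) ^ 2 + (σ'' : ℂ) ^ 2 ≠ 0 := by
    exact_mod_cast (by positivity : σ' ^ 2 + σ'' ^ 2 ≠ 0)
  have hschur := det_powerBlock_sub hn (fun j => ((F' j ⬝ᵥ ξ : ℝ) : ℂ))
    (fun j => ((F'' j ⬝ᵥ ξ : ℝ) : ℂ))
    (fun j => ((F' j ⬝ᵥ F' j + F'' j ⬝ᵥ F'' j : ℝ) : ℂ)) hs hσ
  have hs_nonneg : 0 ≤ ξ ⬝ᵥ ξ := by
    simpa using dotProduct_star_self_nonneg ξ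
  rw [← det_submatrix_equiv_self (symbolIndexEquiv n), symbolS_submatrix,
    det_fromBlocks_of_mul_eq _ _ _ _ _ (blockDiagonal_fieldBlock_mul_rotationColumn _ _ hs hσ),
    det_blockDiagonal, Finset.prod_const, Finset.card_univ, Fintype.card_fin, det_fieldBlock]
  obtain ⟨k, rfl⟩ : ∃ k, n = k + 1 := ⟨n - 1, by omega⟩
  have split (s N : ℂ) :
      (s ^ 2 * N) ^ (k + 1) = s * N * (s ^ (2 * (k + 1) - 1) * N ^ (k + 1 - 1)) := by
    rw [show 2 * (k + 1) - 1 = 2 * k + 1 by omega, Nat.add_sub_cancel]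
    ring
  rw [split, ← mul_assoc, hschur]
  norm_cast
  rw [Real.norm_eq_abs, abs_mul, abs_neg, abs_mul,
    abs_of_pos (by positivity : 0 < 2 * σ' * σ''),
    abs_of_nonneg (by positivity :
      0 ≤ (ξ ⬝ᵥ ξ) ^ (2 * (k + 1) - 1) * (σ' ^ 2 + σ'' ^ 2) ^ (k + 1 - 1))]
  simp only [Fin.castLE]
  simp
  ring
end
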